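/- arXiv:1511.05894 — 4 statements merged into one kernel-verified Lean document; each statement's English description precedes it below -/
import Mathlib

section
/- Let H₁ and H₂ be complex Hilbert spaces, T > 0 and C > 0. Let F : ℝ → B(H₁,H₂) be continuous in the operator norm with F(t) = 0 for t ≤ 0, and suppose there is a function F̃ defined on {t ∈ ℂ : Re t ≥ T} with values in B(H₁,H₂), holomorphic on {Re t > T}, continuous on {Re t ≥ T}, satisfying F̃(t) = F(t) for all real t ≥ T and ‖F̃(t)‖ ≤ C|t|^{−2} for all t with Re t ≥ T. Then G₊(λ) := ∫₀^T e^{iλt} F(t) dt + i ∫₀^∞ e^{iλ(T+is)} F̃(T+is) ds is absolutely convergent for every λ with Re λ ≥ 0, the map λ ↦ G₊(λ) is holomorphic on the open half-plane {Re λ > 0}, and it is continuous on the closed half-plane {Re λ ≥ 0}. -/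
open MeasureTheory Set

section helpers

variable {E : Type*} [NormedAddCommGroup E] [NormedSpace ℂ E]

lemma gp_norm_exp (T : ℝ) (z p : ℂ) (M : ℝ) (hM : |z.im| ≤ M) (h0 : 0 ≤ p.re) (h1 : p.re ≤ T)
    (δ : ℝ) (hδ : δ ≤ z.re) (h2 : 0 ≤ p.im) :
    ‖Complex.exp (Complex.I * z * p)‖ ≤ Real.exp (M * T) * Real.exp (-(δ * p.im)) := by
  rw [Complex.norm_exp, ← Real.exp_add]
  apply Real.exp_le_exp.2
  have h : (Complex.I * z * p).re = -z.im * p.re - z.re * p.im := by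
    simp [Complex.mul_re, Complex.mul_im]
  rw [h]
  have hM0 : 0 ≤ M := (abs_nonneg _).trans hM
  have a1 : -z.im * p.re ≤ M * p.re :=
    mul_le_mul_of_nonneg_right ((neg_le_abs _).trans hM) h0
  have a2 : M * p.re ≤ M * T := mul_le_mul_of_nonneg_left h1 hM0
  have a3 : δ * p.im ≤ z.re * p.im := mul_le_mul_of_nonneg_right hδ h2
  linarith

lemma gp_meas (μ : Measure ℝ) (g : ℝ → E) (hg : Integrable g μ) (p : ℝ → ℂ) (hp : Continuous p)
    (z : ℂ) : AEStronglyMeasurable (fun t => Complex.exp (Complex.I * z * p t) • g t) μ := by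
  have : Continuous (fun t => Complex.exp (Complex.I * z * p t)) := by fun_prop
  exact this.aestronglyMeasurable.smul hg.1

lemma gp_bound (T : ℝ) (z p : ℂ) (M : ℝ) (hM : |z.im| ≤ M) (h0 : 0 ≤ p.re) (h1 : p.re ≤ T)
    (hz : 0 ≤ z.re) (h2 : 0 ≤ p.im) (x : E) :
    ‖Complex.exp (Complex.I * z * p) • x‖ ≤ Real.exp (M * T) * ‖x‖ := by
  rw [norm_smul]
  have := gp_norm_exp T z p M hM h0 h1 0 hz h2
  simp only [zero_mul, neg_zero, Real.exp_zero, mul_one] at this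
  gcongr

lemma gp_integrable (T : ℝ) (μ : Measure ℝ) (g : ℝ → E) (hg : Integrable g μ) (p : ℝ → ℂ)
    (hp : Continuous p)
    (hpb : ∀ᵐ t ∂μ, 0 ≤ (p t).re ∧ (p t).re ≤ T ∧ 0 ≤ (p t).im) (z : ℂ) (hz : 0 ≤ z.re) :
    Integrable (fun t => Complex.exp (Complex.I * z * p t) • g t) μ := by
  refine Integrable.mono' (hg.norm.const_mul (Real.exp (|z.im| * T))) (gp_meas μ g hg p hp z) ?_
  filter_upwards [hpb] with t ht
  exact gp_bound T z (p t) _ le_rfl ht.1 ht.2.1 hz ht.2.2 _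

lemma gp_continuousOn (T : ℝ) (μ : Measure ℝ) (g : ℝ → E) (hg : Integrable g μ) (p : ℝ → ℂ)
    (hp : Continuous p)
    (hpb : ∀ᵐ t ∂μ, 0 ≤ (p t).re ∧ (p t).re ≤ T ∧ 0 ≤ (p t).im) :
    ContinuousOn (fun z => ∫ t, Complex.exp (Complex.I * z * p t) • g t ∂μ) {z : ℂ | 0 ≤ z.re} := by
  intro z₀ hz₀
  refine continuousWithinAt_of_dominated
    (bound := fun t => Real.exp ((|z₀.im| + 1) * T) * ‖g t‖) ?_ ?_ (hg.norm.const_mul _) ?_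
  · exact Filter.Eventually.of_forall fun z => gp_meas μ g hg p hp z
  · have ho : IsOpen {z : ℂ | |z.im| < |z₀.im| + 1} :=
      isOpen_lt (by fun_prop) (by fun_prop)
    have hm : {z : ℂ | |z.im| < |z₀.im| + 1} ∈ nhds z₀ := ho.mem_nhds (by simp)
    filter_upwards [self_mem_nhdsWithin, mem_nhdsWithin_of_mem_nhds hm] with z hz hz'
    filter_upwards [hpb] with t ht
    exact gp_bound T z (p t) _ (le_of_lt hz') ht.1 ht.2.1 hz ht.2.2 _
  · refine Filter.Eventually.of_forall fun t => Continuous.continuousWithinAt ?_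
    fun_prop

lemma gp_differentiableOn (T : ℝ) (hT : 0 < T) (μ : Measure ℝ) (g : ℝ → E) (hg : Integrable g μ)
    (p : ℝ → ℂ) (hp : Continuous p)
    (hpb : ∀ᵐ t ∂μ, 0 ≤ (p t).re ∧ (p t).re ≤ T ∧ 0 ≤ (p t).im) :
    DifferentiableOn ℂ (fun z => ∫ t, Complex.exp (Complex.I * z * p t) • g t ∂μ)
      {z : ℂ | 0 < z.re} := by
  intro z₀ hz₀
  have hz₀' : 0 < z₀.re := hz₀
  set δ := z₀.re / 2 with hδ
  have hδ0 : 0 < δ := by positivity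
  set M := |z₀.im| + 1 with hM
  have ho1 : IsOpen {z : ℂ | |z.im| < M} := isOpen_lt (by fun_prop) (by fun_prop)
  have ho2 : IsOpen {z : ℂ | δ < z.re} := isOpen_lt (by fun_prop) (by fun_prop)
  have ho : IsOpen {z : ℂ | |z.im| < M ∧ δ < z.re} := ho1.inter ho2
  have hm : {z : ℂ | |z.im| < M ∧ δ < z.re} ∈ nhds z₀ :=
    ho.mem_nhds ⟨by simp [hM], by rw [hδ]; linarith⟩
  refine DifferentiableAt.differentiableWithinAt ?_
  refine (hasDerivAt_integral_of_dominated_loc_of_deriv_le (μ := μ)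
    (F := fun z t => Complex.exp (Complex.I * z * p t) • g t)
    (F' := fun z t => (Complex.exp (Complex.I * z * p t) * (Complex.I * p t)) • g t)
    (bound := fun t => (Real.exp (M * T) * (T + 1 / δ)) * ‖g t‖)
    hm ?_ ?_ ?_ ?_ (hg.norm.const_mul _) ?_).2.differentiableAt
  · exact Filter.Eventually.of_forall fun z => gp_meas μ g hg p hp z
  · exact gp_integrable T μ g hg p hp hpb z₀ hz₀'.le
  · have : Continuous (fun t => Complex.exp (Complex.I * z₀ * p t) * (Complex.I * p t)) := by
      fun_prop
    exact this.aestronglyMeasurable.smul hg.1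
  · filter_upwards [hpb] with t ⟨h0, h1, h2⟩ z hz
    rw [norm_smul, norm_mul, norm_mul, Complex.norm_I, one_mul]
    refine mul_le_mul_of_nonneg_right ?_ (norm_nonneg _)
    have b1 := gp_norm_exp T z (p t) M hz.1.le h0 h1 δ hz.2.le h2
    have b2 : ‖p t‖ ≤ T + (p t).im := by
      have := Complex.norm_le_abs_re_add_abs_im (p t)
      rw [abs_of_nonneg h0, abs_of_nonneg h2] at this
      linarith
    set y := (p t).im with hy
    have b3 : Real.exp (-(δ * y)) * (T + y) ≤ T + 1 / δ := by
      have c1 : Real.exp (-(δ * y)) ≤ 1 := Real.exp_le_one_iff.2 (by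
        have := mul_nonneg hδ0.le h2
        linarith)
      have c2 : Real.exp (-(δ * y)) * y ≤ 1 / δ := by
        rw [Real.exp_neg, le_div_iff₀ hδ0, mul_assoc, inv_mul_le_iff₀ (Real.exp_pos _)]
        have := Real.add_one_le_exp (δ * y)
        linarith
      nlinarith
    calc ‖Complex.exp (Complex.I * z * p t)‖ * ‖p t‖
        ≤ (Real.exp (M * T) * Real.exp (-(δ * y))) * (T + y) := by gcongr
      _ = Real.exp (M * T) * (Real.exp (-(δ * y)) * (T + y)) := by ring
      _ ≤ _ := by gcongr
  · refine Filter.Eventually.of_forall fun t z _ => ?_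
    have h : HasDerivAt (fun z : ℂ => Complex.I * z * p t) (Complex.I * p t) z := by
      simpa using ((hasDerivAt_id z).const_mul Complex.I).mul_const (p t)
    exact h.cexp.smul_const (g t)

end helpers

/-- The `Γ₊`-contour representation
`G₊(λ) = ∫₀^T e^{iλt} F(t) dt + i ∫₀^∞ e^{iλ(T+is)} F̃(T+is) ds`
converges absolutely for `Re λ ≥ 0`, is holomorphic on `{Re λ > 0}`, and is continuous
on `{Re λ ≥ 0}`. -/
theorem gamma_plus_representation_holomorphic
    {H₁ H₂ : Type*} [NormedAddCommGroup H₁] [InnerProductSpace ℂ H₁] [CompleteSpace H₁]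
    [NormedAddCommGroup H₂] [InnerProductSpace ℂ H₂] [CompleteSpace H₂]
    (T C : ℝ) (hT : 0 < T) (hC : 0 < C)
    (F : ℝ → (H₁ →L[ℂ] H₂)) (hFcont : Continuous F)
    (hF0 : ∀ t : ℝ, t ≤ 0 → F t = 0)
    (Ft : ℂ → (H₁ →L[ℂ] H₂))
    (hFtHol : DifferentiableOn ℂ Ft {t : ℂ | T < t.re})
    (hFtCont : ContinuousOn Ft {t : ℂ | T ≤ t.re})
    (hAgree : ∀ t : ℝ, T ≤ t → Ft (t : ℂ) = F t)
    (hFtBound : ∀ t : ℂ, T ≤ t.re → ‖Ft t‖ ≤ C / ‖t‖ ^ 2) :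
    (∀ z : ℂ, 0 ≤ z.re →
      IntegrableOn (fun t : ℝ => Complex.exp (Complex.I * z * (t : ℂ)) • F t) (Ioc 0 T) ∧
      IntegrableOn (fun s : ℝ =>
        Complex.exp (Complex.I * z * ((T : ℂ) + Complex.I * (s : ℂ))) •
          Ft ((T : ℂ) + Complex.I * (s : ℂ))) (Ioi 0)) ∧
    DifferentiableOn ℂ
      (fun z : ℂ =>
        (∫ t in Ioc (0 : ℝ) T, Complex.exp (Complex.I * z * (t : ℂ)) • F t)
          + Complex.I • ∫ s in Ioi (0 : ℝ),
              Complex.exp (Complex.I * z * ((T : ℂ) + Complex.I * (s : ℂ))) •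
                Ft ((T : ℂ) + Complex.I * (s : ℂ)))
      {z : ℂ | 0 < z.re} ∧
    ContinuousOn
      (fun z : ℂ =>
        (∫ t in Ioc (0 : ℝ) T, Complex.exp (Complex.I * z * (t : ℂ)) • F t)
          + Complex.I • ∫ s in Ioi (0 : ℝ),
              Complex.exp (Complex.I * z * ((T : ℂ) + Complex.I * (s : ℂ))) •
                Ft ((T : ℂ) + Complex.I * (s : ℂ)))
      {z : ℂ | 0 ≤ z.re} := by
  have hg1 : Integrable F (volume.restrict (Ioc 0 T)) :=
    (hFcont.integrableOn_Icc (a := 0) (b := T)).mono_set Ioc_subset_Icc_self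
  have hp1 : Continuous (fun t : ℝ => (t : ℂ)) := by fun_prop
  have hb1 : ∀ᵐ t : ℝ ∂(volume.restrict (Ioc 0 T)),
      0 ≤ ((t : ℂ)).re ∧ ((t : ℂ)).re ≤ T ∧ 0 ≤ ((t : ℂ)).im := by
    filter_upwards [ae_restrict_mem measurableSet_Ioc] with t ht
    simpa using ⟨ht.1.le, ht.2⟩
  have hp2 : Continuous (fun s : ℝ => (T : ℂ) + Complex.I * (s : ℂ)) := by fun_prop
  have hb2 : ∀ᵐ s : ℝ ∂(volume.restrict (Ioi 0)),
      0 ≤ ((T : ℂ) + Complex.I * (s : ℂ)).re ∧ ((T : ℂ) + Complex.I * (s : ℂ)).re ≤ T ∧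
        0 ≤ ((T : ℂ) + Complex.I * (s : ℂ)).im := by
    filter_upwards [ae_restrict_mem measurableSet_Ioi] with s hs
    have hs' : 0 < s := hs
    simpa using ⟨hT.le, hs'.le⟩
  have hg2 : Integrable (fun s : ℝ => Ft ((T : ℂ) + Complex.I * (s : ℂ)))
      (volume.restrict (Ioi 0)) := by
    have hc : Continuous (fun s : ℝ => Ft ((T : ℂ) + Complex.I * (s : ℂ))) :=
      hFtCont.comp_continuous hp2 (fun s => by simp)
    refine Integrable.mono'
      ((integrable_inv_one_add_sq.const_mul (C * (1 + 1 / T ^ 2))).restrict)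
      hc.aestronglyMeasurable (Filter.Eventually.of_forall fun s => ?_)
    refine (hFtBound _ (by simp)).trans ?_
    have hn : ‖(T : ℂ) + Complex.I * (s : ℂ)‖ ^ 2 = T ^ 2 + s ^ 2 := by
      rw [← Complex.normSq_eq_norm_sq, Complex.normSq_apply]
      simp
      ring
    rw [hn, ← div_eq_mul_inv, div_le_div_iff₀ (by positivity) (by positivity), mul_assoc]
    refine mul_le_mul_of_nonneg_left ?_ hC.le
    have e : (1 + 1 / T ^ 2) * (T ^ 2 + s ^ 2) = T ^ 2 + s ^ 2 + 1 + s ^ 2 / T ^ 2 := by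
      field_simp
      ring
    rw [e]
    have : 0 ≤ s ^ 2 / T ^ 2 := by positivity
    nlinarith [sq_nonneg T]
  refine ⟨fun z hz => ⟨gp_integrable T _ F hg1 _ hp1 hb1 z hz,
    gp_integrable T _ _ hg2 _ hp2 hb2 z hz⟩, ?_, ?_⟩
  · exact (gp_differentiableOn T hT _ F hg1 _ hp1 hb1).add
      ((gp_differentiableOn T hT _ _ hg2 _ hp2 hb2).const_smul Complex.I)
  · exact (gp_continuousOn T _ F hg1 _ hp1 hb1).add
      ((gp_continuousOn T _ _ hg2 _ hp2 hb2).const_smul Complex.I)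
end

section
/- Let H₁ and H₂ be complex Hilbert spaces, T > 0 and C > 0. Let F : ℝ → B(H₁,H₂) be continuous in the operator norm with F(t) = 0 for t ≤ 0, and suppose there is a function F̃ defined on {t ∈ ℂ : Re t ≥ T} with values in B(H₁,H₂), holomorphic on {Re t > T}, continuous on {Re t ≥ T}, satisfying F̃(t) = F(t) for all real t ≥ T and ‖F̃(t)‖ ≤ C|t|^{−2} for all t with Re t ≥ T. Then G₋(λ) := ∫₀^T e^{iλt} F(t) dt − i ∫₀^∞ e^{iλ(T−is)} F̃(T−is) ds is absolutely convergent for every λ with Re λ ≤ 0, the map λ ↦ G₋(λ) is holomorphic on the open half-plane {Re λ < 0}, and it is continuous on the closed half-plane {Re λ ≤ 0}. -/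
open MeasureTheory Set

theorem gm_aux {E : Type*} [NormedAddCommGroup E] [NormedSpace ℂ E]
    (μ : Measure ℝ) (c : ℝ → ℂ) (hc : Continuous c) (f : ℝ → E) (hf : Integrable f μ) (T : ℝ)
    (hT : 0 < T)
    (hb : ∀ᵐ s ∂μ, ∀ w : ℂ, w.re ≤ 0 →
      ‖Complex.exp (Complex.I * w * c s)‖ ≤ Real.exp (‖w‖ * T)) :
    (∀ z : ℂ, z.re ≤ 0 → Integrable (fun s => Complex.exp (Complex.I * z * c s) • f s) μ) ∧
    DifferentiableOn ℂ (fun z : ℂ => ∫ s, Complex.exp (Complex.I * z * c s) • f s ∂μ)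
      {z : ℂ | z.re < 0} ∧
    ContinuousOn (fun z : ℂ => ∫ s, Complex.exp (Complex.I * z * c s) • f s ∂μ)
      {z : ℂ | z.re ≤ 0} := by
  have hm : ∀ z : ℂ, AEStronglyMeasurable (fun s => Complex.exp (Complex.I * z * c s) • f s) μ := by
    intro z
    exact (Continuous.aestronglyMeasurable (by fun_prop)).smul hf.1
  have hi : ∀ z : ℂ, z.re ≤ 0 →
      Integrable (fun s => Complex.exp (Complex.I * z * c s) • f s) μ := by
    intro z hz
    refine (hf.norm.const_mul (Real.exp (‖z‖ * T))).mono' (hm z) ?_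
    filter_upwards [hb] with s hs
    rw [norm_smul]
    exact mul_le_mul_of_nonneg_right (hs z hz) (norm_nonneg _)
  have hM : ∀ z₀ : ℂ, ∀ᵐ s ∂μ, ∀ w : ℂ, w.re ≤ 0 → dist w z₀ ≤ 1 →
      ‖Complex.exp (Complex.I * w * c s) • f s‖ ≤ Real.exp ((‖z₀‖ + 1) * T) * ‖f s‖ := by
    intro z₀
    filter_upwards [hb] with s hs w hw hd
    rw [norm_smul]
    refine mul_le_mul_of_nonneg_right ((hs w hw).trans ?_) (norm_nonneg _)
    have : ‖w‖ ≤ ‖z₀‖ + 1 := by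
      rw [dist_eq_norm] at hd
      have := norm_le_norm_add_norm_sub' w z₀
      linarith
    gcongr
  refine ⟨hi, ?_, ?_⟩
  · intro z₀ hz₀
    have ho : IsOpen {z : ℂ | z.re < 0} := isOpen_lt Complex.continuous_re continuous_const
    obtain ⟨ε, hε, hball⟩ := Metric.isOpen_iff.1 ho z₀ hz₀
    obtain ⟨r, hr, hr1, hrε⟩ : ∃ r : ℝ, 0 < r ∧ 2 * r ≤ 1 ∧ 2 * r < ε :=
      ⟨min (1 / 2) (ε / 3), by positivity, by have := min_le_left (1 / 2) (ε / 3); linarith,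
        by have := min_le_right (1 / 2) (ε / 3); linarith⟩
    have hd : ∀ s : ℝ, ∀ x : ℂ, HasDerivAt (fun z : ℂ => Complex.exp (Complex.I * z * c s) • f s)
        ((Complex.exp (Complex.I * x * c s) * (Complex.I * c s)) • f s) x := by
      intro s x
      have h1 : HasDerivAt (fun z : ℂ => Complex.I * z * c s) (Complex.I * c s) x := by
        simpa using ((hasDerivAt_id x).const_mul Complex.I).mul_const (c s)
      exact h1.cexp.smul_const (f s)
    refine (hasDerivAt_integral_of_dominated_loc_of_deriv_le (𝕜 := ℂ)
      (F := fun (z : ℂ) (s : ℝ) => Complex.exp (Complex.I * z * c s) • f s)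
      (F' := fun (x : ℂ) (s : ℝ) =>
        (Complex.exp (Complex.I * x * c s) * (Complex.I * c s)) • f s)
      (bound := fun s => Real.exp ((‖z₀‖ + 1) * T) * ‖f s‖ / r)
      (Metric.ball_mem_nhds z₀ hr) (Filter.Eventually.of_forall hm) (hi z₀ (le_of_lt hz₀))
      ((Continuous.aestronglyMeasurable (by fun_prop)).smul hf.1) ?_
      ((hf.norm.const_mul _).div_const r)
      (Filter.Eventually.of_forall fun s x _ => hd s x)).2.differentiableAt.differentiableWithinAt
    filter_upwards [hM z₀] with s hs x hx
    rw [← (hd s x).deriv]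
    refine Complex.norm_deriv_le_of_forall_mem_sphere_norm_le hr
      (Differentiable.diffContOnCl fun y => (hd s y).differentiableAt) ?_
    intro w hw
    have h2 : dist w z₀ < 2 * r := by
      have := dist_triangle w x z₀
      rw [Metric.mem_sphere] at hw
      rw [Metric.mem_ball] at hx
      linarith
    exact hs w (le_of_lt (hball (h2.trans hrε))) (by linarith)
  · intro z₀ hz₀
    refine continuousWithinAt_of_dominated (bound := fun s => Real.exp ((‖z₀‖ + 1) * T) * ‖f s‖)
      (Filter.Eventually.of_forall hm) ?_ (hf.norm.const_mul _) ?_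
    · filter_upwards [self_mem_nhdsWithin,
        mem_nhdsWithin_of_mem_nhds (Metric.closedBall_mem_nhds z₀ one_pos)] with w hw hd
      filter_upwards [hM z₀] with s hs
      exact hs w hw hd
    · refine Filter.Eventually.of_forall fun s => Continuous.continuousWithinAt ?_
      fun_prop

/-- The `Γ₋`-contour representation
`G₋(λ) = ∫₀^T e^{iλt} F(t) dt − i ∫₀^∞ e^{iλ(T−is)} F̃(T−is) ds`
converges absolutely for `Re λ ≤ 0`, is holomorphic on `{Re λ < 0}`, and is continuous
on `{Re λ ≤ 0}`. -/
theorem gamma_minus_representation_holomorphic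
    {H₁ H₂ : Type*} [NormedAddCommGroup H₁] [InnerProductSpace ℂ H₁] [CompleteSpace H₁]
    [NormedAddCommGroup H₂] [InnerProductSpace ℂ H₂] [CompleteSpace H₂]
    (T C : ℝ) (hT : 0 < T) (hC : 0 < C)
    (F : ℝ → (H₁ →L[ℂ] H₂)) (hFcont : Continuous F)
    (hF0 : ∀ t : ℝ, t ≤ 0 → F t = 0)
    (Ft : ℂ → (H₁ →L[ℂ] H₂))
    (hFtHol : DifferentiableOn ℂ Ft {t : ℂ | T < t.re})
    (hFtCont : ContinuousOn Ft {t : ℂ | T ≤ t.re})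
    (hAgree : ∀ t : ℝ, T ≤ t → Ft (t : ℂ) = F t)
    (hFtBound : ∀ t : ℂ, T ≤ t.re → ‖Ft t‖ ≤ C / ‖t‖ ^ 2) :
    (∀ z : ℂ, z.re ≤ 0 →
      IntegrableOn (fun t : ℝ => Complex.exp (Complex.I * z * (t : ℂ)) • F t) (Ioc 0 T) ∧
      IntegrableOn (fun s : ℝ =>
        Complex.exp (Complex.I * z * ((T : ℂ) - Complex.I * (s : ℂ))) •
          Ft ((T : ℂ) - Complex.I * (s : ℂ))) (Ioi 0)) ∧
    DifferentiableOn ℂ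
      (fun z : ℂ =>
        (∫ t in Ioc (0 : ℝ) T, Complex.exp (Complex.I * z * (t : ℂ)) • F t)
          - Complex.I • ∫ s in Ioi (0 : ℝ),
              Complex.exp (Complex.I * z * ((T : ℂ) - Complex.I * (s : ℂ))) •
                Ft ((T : ℂ) - Complex.I * (s : ℂ)))
      {z : ℂ | z.re < 0} ∧
    ContinuousOn
      (fun z : ℂ =>
        (∫ t in Ioc (0 : ℝ) T, Complex.exp (Complex.I * z * (t : ℂ)) • F t)
          - Complex.I • ∫ s in Ioi (0 : ℝ),
              Complex.exp (Complex.I * z * ((T : ℂ) - Complex.I * (s : ℂ))) •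
                Ft ((T : ℂ) - Complex.I * (s : ℂ)))
      {z : ℂ | z.re ≤ 0} := by
  obtain ⟨a1, a2, a3⟩ := gm_aux (volume.restrict (Ioc 0 T)) (fun t : ℝ => (t : ℂ))
    Complex.continuous_ofReal F
    ((hFcont.integrableOn_Icc (a := 0) (b := T)).mono_set Ioc_subset_Icc_self) T hT (by
      filter_upwards [ae_restrict_mem measurableSet_Ioc] with s hs w hw
      rw [Complex.norm_exp, Real.exp_le_exp]
      have h1 : (Complex.I * w * (s : ℂ)).re = -w.im * s := by simp
      rw [h1]
      have h2 := Complex.abs_im_le_norm w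
      have h3 := neg_abs_le w.im
      have h4 := norm_nonneg w
      nlinarith [hs.1, hs.2])
  have hre : ∀ s : ℝ, T ≤ ((T : ℂ) - Complex.I * (s : ℂ)).re := by intro s; simp
  have hcc : Continuous (fun s : ℝ => (T : ℂ) - Complex.I * (s : ℂ)) := by fun_prop
  have hint : Integrable (fun s : ℝ => Ft ((T : ℂ) - Complex.I * (s : ℂ)))
      (volume.restrict (Ioi 0)) := by
    refine Integrable.restrict ?_
    refine (integrable_inv_one_add_sq.const_mul (C * (1 + 1 / T ^ 2))).mono'
      (hFtCont.comp_continuous hcc hre).aestronglyMeasurable ?_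
    refine Filter.Eventually.of_forall fun s => (hFtBound _ (hre s)).trans ?_
    have h1 : ‖(T : ℂ) - Complex.I * (s : ℂ)‖ ^ 2 = T ^ 2 + s ^ 2 := by
      rw [Complex.sq_norm, Complex.normSq_apply]
      simp
      ring
    rw [h1, ← div_eq_mul_inv, div_le_div_iff₀ (by positivity) (by positivity), mul_assoc]
    refine mul_le_mul_of_nonneg_left ?_ hC.le
    have h2 : (1 + 1 / T ^ 2) * (T ^ 2 + s ^ 2) = T ^ 2 + s ^ 2 + 1 + s ^ 2 / T ^ 2 := by
      field_simp
      ring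
    rw [h2]
    have : 0 ≤ s ^ 2 / T ^ 2 := by positivity
    nlinarith [sq_nonneg T]
  obtain ⟨b1, b2, b3⟩ := gm_aux (volume.restrict (Ioi 0))
    (fun s : ℝ => (T : ℂ) - Complex.I * (s : ℂ)) hcc _ hint T hT (by
      filter_upwards [ae_restrict_mem measurableSet_Ioi] with s hs w hw
      rw [Complex.norm_exp, Real.exp_le_exp]
      have h1 : (Complex.I * w * ((T : ℂ) - Complex.I * (s : ℂ))).re = -w.im * T + w.re * s := by
        simp
      rw [h1]
      have h2 := Complex.abs_im_le_norm w
      have h3 := neg_abs_le w.im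
      have h5 : w.re * s ≤ 0 := mul_nonpos_of_nonpos_of_nonneg hw (le_of_lt hs)
      nlinarith)
  exact ⟨fun z hz => ⟨a1 z hz, b1 z hz⟩, a2.sub (b2.const_smul Complex.I),
    a3.sub (b3.const_smul Complex.I)⟩
end

section
/- Let H₁ and H₂ be complex Hilbert spaces, T > 0 and C > 0. Let F : ℝ → B(H₁,H₂) be continuous in the operator norm with F(t) = 0 for t ≤ 0, and suppose there is a function F̃ defined on {t ∈ ℂ : Re t ≥ T} with values in B(H₁,H₂), holomorphic on {Re t > T}, continuous on {Re t ≥ T}, satisfying F̃(t) = F(t) for all real t ≥ T and ‖F̃(t)‖ ≤ C|t|^{−2} for all t with Re t ≥ T. Then for every λ ∈ ℂ with Re λ ≤ 0, ‖∫₀^T e^{iλt} F(t) dt − i ∫₀^∞ e^{iλ(T−is)} F̃(T−is) ds‖ ≤ (T · sup_{0≤t≤T} ‖F(t)‖ + πC/(2T)) · e^{T|Im λ|}. -/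
open MeasureTheory Set

/-- Quantitative bound on the `Γ₋`-contour representation: for `Re λ ≤ 0`,
`‖∫₀^T e^{iλt} F(t) dt − i ∫₀^∞ e^{iλ(T−is)} F̃(T−is) ds‖
  ≤ (T·sup_{0≤t≤T}‖F(t)‖ + πC/(2T))·e^{T|Im λ|}`. -/
theorem gamma_minus_representation_bound
    {H₁ H₂ : Type*} [NormedAddCommGroup H₁] [InnerProductSpace ℂ H₁] [CompleteSpace H₁]
    [NormedAddCommGroup H₂] [InnerProductSpace ℂ H₂] [CompleteSpace H₂]
    (T C : ℝ) (hT : 0 < T) (hC : 0 < C)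
    (F : ℝ → (H₁ →L[ℂ] H₂)) (hFcont : Continuous F)
    (hF0 : ∀ t : ℝ, t ≤ 0 → F t = 0)
    (Ft : ℂ → (H₁ →L[ℂ] H₂))
    (hFtHol : DifferentiableOn ℂ Ft {t : ℂ | T < t.re})
    (hFtCont : ContinuousOn Ft {t : ℂ | T ≤ t.re})
    (hAgree : ∀ t : ℝ, T ≤ t → Ft (t : ℂ) = F t)
    (hFtBound : ∀ t : ℂ, T ≤ t.re → ‖Ft t‖ ≤ C / ‖t‖ ^ 2) :
    ∀ z : ℂ, z.re ≤ 0 →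
      ‖(∫ t in Ioc (0 : ℝ) T, Complex.exp (Complex.I * z * (t : ℂ)) • F t)
          - Complex.I • ∫ s in Ioi (0 : ℝ),
              Complex.exp (Complex.I * z * ((T : ℂ) - Complex.I * (s : ℂ))) •
                Ft ((T : ℂ) - Complex.I * (s : ℂ))‖
        ≤ (T * sSup ((fun t : ℝ => ‖F t‖) '' Icc 0 T) + Real.pi * C / (2 * T)) *
            Real.exp (T * |z.im|) := by
  intro z hz
  set M := sSup ((fun t : ℝ => ‖F t‖) '' Icc 0 T) with hM
  set E := Real.exp (T * |z.im|) with hE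
  have hbdd : BddAbove ((fun t : ℝ => ‖F t‖) '' Icc 0 T) :=
    (isCompact_Icc.image hFcont.norm).bddAbove
  have hFM : ∀ t ∈ Icc (0 : ℝ) T, ‖F t‖ ≤ M := fun t ht =>
    le_csSup hbdd (mem_image_of_mem _ ht)
  have habs : -z.im ≤ |z.im| := neg_le_abs _
  have hEpos : 0 < E := Real.exp_pos _
  have h1 : ‖∫ t in Ioc (0 : ℝ) T, Complex.exp (Complex.I * z * (t : ℂ)) • F t‖ ≤ T * M * E := by
    have h := norm_setIntegral_le_of_norm_le_const (μ := volume) (s := Ioc (0 : ℝ) T) (C := E * M)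
      (f := fun t : ℝ => Complex.exp (Complex.I * z * (t : ℂ)) • F t)
      (by simp) (by
        intro t ht
        rw [norm_smul, Complex.norm_exp]
        refine mul_le_mul ?_ (hFM t ⟨ht.1.le, ht.2⟩) (norm_nonneg _) hEpos.le
        apply Real.exp_le_exp.mpr
        have e : (Complex.I * z * (t : ℂ)).re = t * (-z.im) := by simp; ring
        rw [e]
        calc t * (-z.im) ≤ t * |z.im| := mul_le_mul_of_nonneg_left habs ht.1.le
          _ ≤ T * |z.im| := mul_le_mul_of_nonneg_right ht.2 (abs_nonneg _))
    have hv : (volume : Measure ℝ).real (Ioc (0 : ℝ) T) = T := by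
      simp [hT.le]
    rw [hv] at h
    linarith
  have hTi : 0 < T⁻¹ := inv_pos.mpr hT
  have hint : Integrable (fun s : ℝ => (1 + (T⁻¹ * s) ^ 2)⁻¹) :=
    integrable_inv_one_add_sq.comp_mul_left' hTi.ne'
  have hval : ∫ s in Ioi (0 : ℝ), (1 + (T⁻¹ * s) ^ 2)⁻¹ = T * (Real.pi / 2) := by
    have h := integral_comp_mul_left_Ioi (fun s : ℝ => (1 + s ^ 2)⁻¹) 0 hTi
    rw [h, mul_zero, integral_Ioi_inv_one_add_sq]
    simp
  have h2 : ‖∫ s in Ioi (0 : ℝ),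
              Complex.exp (Complex.I * z * ((T : ℂ) - Complex.I * (s : ℂ))) •
                Ft ((T : ℂ) - Complex.I * (s : ℂ))‖ ≤ Real.pi * C / (2 * T) * E := by
    have h := norm_integral_le_of_norm_le (μ := volume.restrict (Ioi (0 : ℝ)))
      (f := fun s : ℝ => Complex.exp (Complex.I * z * ((T : ℂ) - Complex.I * (s : ℂ))) •
                Ft ((T : ℂ) - Complex.I * (s : ℂ)))
      (g := fun s : ℝ => (E * (C / T ^ 2)) * (1 + (T⁻¹ * s) ^ 2)⁻¹)
      (hint.integrableOn.const_mul _) (by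
        refine (ae_restrict_iff' measurableSet_Ioi).mpr (Filter.Eventually.of_forall ?_)
        intro s hs
        have hs : 0 < s := hs
        rw [norm_smul, Complex.norm_exp, mul_assoc E]
        refine mul_le_mul ?_ ?_ (norm_nonneg _) hEpos.le
        · apply Real.exp_le_exp.mpr
          have e : (Complex.I * z * ((T : ℂ) - Complex.I * (s : ℂ))).re
              = T * (-z.im) + z.re * s := by simp; ring
          rw [e]
          have a1 := mul_le_mul_of_nonneg_left habs hT.le
          have a2 := mul_nonpos_of_nonpos_of_nonneg hz hs.le
          linarith
        · refine (hFtBound _ (by simp)).trans (le_of_eq ?_)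
          have e : ‖(T : ℂ) - Complex.I * (s : ℂ)‖ ^ 2 = T ^ 2 + s ^ 2 := by
            rw [← Complex.normSq_eq_norm_sq, Complex.normSq_apply]; simp; ring
          rw [e]
          have : T ^ 2 + s ^ 2 ≠ 0 := by positivity
          field_simp)
    rw [integral_const_mul, hval] at h
    refine h.trans (le_of_eq ?_)
    field_simp
  refine (norm_sub_le _ _).trans ?_
  rw [norm_smul, Complex.norm_I, one_mul, add_mul]
  exact add_le_add h1 h2
end

section
/- Let H₁ and H₂ be complex Hilbert spaces, T > 0, and let j₀ ≥ 0 and k ≥ j₀ + 2 be integers. Let N : ℝ → B(H₁,H₂) be of class C^k in the operator norm with N(t) = 0 for t ≤ 0. Suppose N extends to a function Ñ, holomorphic on {t ∈ ℂ : Re t > T}, such that Ñ and its derivatives Ñ^{(j)} for 0 ≤ j ≤ k are continuous on {Re t ≥ T}, Ñ(t) = N(t) for real t ≥ T, and there are constants C_j with ‖Ñ^{(j)}(t)‖ ≤ C_j |t|^{j₀−j} for all Re t ≥ T and 0 ≤ j ≤ k. Then there exists a holomorphic function G : {λ ∈ ℂ : Im λ > 0} ∪ {λ ∈ ℂ : Re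 λ > 0} → B(H₁,H₂) such that G(λ) = ∫₀^∞ e^{iλt} N(t) dt for all λ with Im λ > 0, and for each 0 ≤ j ≤ k there is a constant C'_j such that ‖G(λ)‖ ≤ C'_j |λ|^{−j} e^{T|Im λ|} for all λ in the domain with |λ| > 1. -/
open MeasureTheory Set

section helpers
open Filter Topology

variable {E : Type*} [NormedAddCommGroup E] [NormedSpace ℂ E] [CompleteSpace E]

lemma aux_diff (μ : Measure ℝ) (f : ℝ → E) (hf : Integrable f μ) (c z₀ : ℂ) (s : Set ℂ)
    (hs : s ∈ 𝓝 z₀) (B : ℝ)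
    (hB : ∀ᵐ t : ℝ ∂μ, ∀ z ∈ s, ‖Complex.exp (c * z * (t : ℂ))‖ ≤ B ∧
      ‖Complex.exp (c * z * (t : ℂ)) * (c * t)‖ ≤ B) :
    DifferentiableAt ℂ (fun z => ∫ t, Complex.exp (c * z * (t : ℂ)) • f t ∂μ) z₀ := by
  have hz₀ : z₀ ∈ s := mem_of_mem_nhds hs
  have hm : ∀ z : ℂ, AEStronglyMeasurable (fun t : ℝ => Complex.exp (c * z * (t : ℂ))) μ :=
    fun z => (by fun_prop : Continuous fun t : ℝ => Complex.exp (c * z * (t : ℂ))).aestronglyMeasurable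
  have hm' : AEStronglyMeasurable (fun t : ℝ => Complex.exp (c * z₀ * (t : ℂ)) * (c * t)) μ :=
    (by fun_prop : Continuous fun t : ℝ =>
      Complex.exp (c * z₀ * (t : ℂ)) * (c * t)).aestronglyMeasurable
  refine (hasDerivAt_integral_of_dominated_loc_of_deriv_le
    (F := fun z t => Complex.exp (c * z * (t : ℂ)) • f t)
    (F' := fun z t => (Complex.exp (c * z * (t : ℂ)) * (c * t)) • f t)
    (bound := fun t => B * ‖f t‖) hs ?_ ?_ ?_ ?_ ?_ ?_).2.differentiableAt
  · exact Eventually.of_forall fun z => (hm z).smul hf.1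
  · refine (hf.norm.const_mul B).mono' ((hm z₀).smul hf.1) ?_
    filter_upwards [hB] with t ht
    rw [norm_smul]
    gcongr
    exact (ht z₀ hz₀).1
  · exact hm'.smul hf.1
  · filter_upwards [hB] with t ht z hz
    rw [norm_smul]
    gcongr
    exact (ht z hz).2
  · exact hf.norm.const_mul B
  · refine Eventually.of_forall fun t z _ => ?_
    have h1 : HasDerivAt (fun z : ℂ => c * z * (t : ℂ)) (c * t) z := by
      simpa using ((hasDerivAt_id z).const_mul c).mul_const (t : ℂ)
    exact h1.cexp.smul_const (f t)

lemma aux_norm_exp (c z : ℂ) (t : ℝ) :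
    ‖Complex.exp (c * z * (t : ℂ))‖ = Real.exp ((c * z).re * t) := by
  rw [Complex.norm_exp, Complex.re_mul_ofReal]

lemma aux_diff_Ioi (f : ℝ → E) (hf : IntegrableOn f (Ioi 0)) (c z₀ : ℂ)
    (h0 : (c * z₀).re < 0) :
    DifferentiableAt ℂ (fun z => ∫ t in Ioi (0 : ℝ), Complex.exp (c * z * (t : ℂ)) • f t) z₀ := by
  set ε := -(c * z₀).re / 2 with hε
  have hεpos : 0 < ε := by rw [hε]; linarith
  have hopen : {z : ℂ | (c * z).re < -ε} ∈ 𝓝 z₀ := by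
    refine (isOpen_lt (by fun_prop) (by fun_prop)).mem_nhds ?_
    show (c * z₀).re < -ε
    rw [hε]; linarith
  refine aux_diff _ f hf c z₀ _ hopen (1 + ‖c‖ / ε) ?_
  filter_upwards [ae_restrict_mem measurableSet_Ioi] with t ht z hz
  have ht : 0 < t := ht
  have hz : (c * z).re < -ε := hz
  have h1 : Real.exp ((c * z).re * t) ≤ Real.exp (-(ε * t)) := by
    apply Real.exp_le_exp.2; nlinarith
  have h2 : Real.exp (-(ε * t)) ≤ 1 := Real.exp_le_one_iff.2 (by nlinarith)
  have h3 : t * Real.exp (-(ε * t)) ≤ 1 / ε := by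
    rw [Real.exp_neg, le_div_iff₀ hεpos]
    have := Real.add_one_le_exp (ε * t)
    rw [mul_assoc, mul_comm, mul_assoc, ← div_eq_inv_mul, div_le_one (Real.exp_pos _)] 
    linarith
  have h4 : 0 ≤ ‖c‖ / ε := by positivity
  constructor
  · rw [aux_norm_exp]; linarith
  · rw [norm_mul, aux_norm_exp, norm_mul, Complex.norm_real, Real.norm_of_nonneg ht.le]
    calc _ ≤ Real.exp (-(ε * t)) * (‖c‖ * t) := by gcongr
      _ = ‖c‖ * (t * Real.exp (-(ε * t))) := by ring
      _ ≤ ‖c‖ * (1 / ε) := by gcongr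
      _ ≤ _ := by rw [mul_one_div]; linarith

lemma aux_diff_Ioc (T : ℝ) (f : ℝ → E) (hf : IntegrableOn f (Ioc 0 T)) (c z₀ : ℂ) :
    DifferentiableAt ℂ (fun z => ∫ t in Ioc (0 : ℝ) T, Complex.exp (c * z * (t : ℂ)) • f t) z₀ := by
  set R := |(c * z₀).re| + 1 with hR
  have hopen : {z : ℂ | |(c * z).re| < R} ∈ 𝓝 z₀ := by
    refine (isOpen_lt (by fun_prop) (by fun_prop)).mem_nhds ?_
    show |(c * z₀).re| < R
    rw [hR]; linarith
  refine aux_diff _ f hf c z₀ _ hopen (Real.exp (R * T) * (1 + ‖c‖ * T)) ?_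
  filter_upwards [ae_restrict_mem measurableSet_Ioc] with t ht z hz
  have hz : |(c * z).re| < R := hz
  have hR0 : 0 < R := by positivity
  obtain ⟨ht0, htT⟩ := ht
  have h1 : Real.exp ((c * z).re * t) ≤ Real.exp (R * T) := by
    apply Real.exp_le_exp.2
    have := le_abs_self (c * z).re
    calc (c * z).re * t ≤ R * t := by gcongr; linarith
      _ ≤ R * T := by gcongr
  have h4 : 0 ≤ ‖c‖ * T := mul_nonneg (norm_nonneg _) (by linarith)
  have h5 : 0 < Real.exp (R * T) := Real.exp_pos _
  constructor
  · rw [aux_norm_exp]; nlinarith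
  · rw [norm_mul, aux_norm_exp, norm_mul, Complex.norm_real, Real.norm_of_nonneg ht0.le]
    calc _ ≤ Real.exp (R * T) * (‖c‖ * T) := by gcongr
      _ ≤ _ := by gcongr; linarith

/-- exponentially damped functions of polynomial growth: integrability and decay. -/
lemma aux_decay (f : ℝ → E) (hf : Continuous f) (n : ℤ)
    (hO : f =O[atTop] fun t : ℝ => t ^ n) (c z : ℂ) (h0 : (c * z).re < 0) :
    IntegrableOn (fun t : ℝ => Complex.exp (c * z * (t : ℂ)) • f t) (Ioi 0) ∧
    Tendsto (fun t : ℝ => Complex.exp (c * z * (t : ℂ)) • f t) atTop (𝓝 0) := by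
  set ε := -(c * z).re / 2 with hε
  have hεpos : 0 < ε := by rw [hε]; linarith
  have h1 : (fun t : ℝ => Complex.exp (c * z * (t : ℂ)) • f t) =O[atTop]
      fun t : ℝ => Real.exp (-ε * t) := by
    have h2 := hO.trans (isLittleO_zpow_exp_pos_mul_atTop n hεpos).isBigO
    have h3 : (fun t : ℝ => Complex.exp (c * z * (t : ℂ))) =O[atTop]
        fun t : ℝ => Real.exp ((c * z).re * t) := by
      refine Asymptotics.IsBigO.of_bound 1 (Eventually.of_forall fun t => ?_)
      rw [aux_norm_exp]; simp
    refine (h3.smul h2).congr_right fun t => ?_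
    rw [smul_eq_mul, ← Real.exp_add]
    congr 1
    rw [hε]; ring
  have hc : Continuous (fun t : ℝ => Complex.exp (c * z * (t : ℂ)) • f t) := by fun_prop
  constructor
  · have := integrable_of_isBigO_exp_neg (a := 0) hεpos hc.norm.continuousOn h1.norm_left
    exact (integrable_norm_iff hc.aestronglyMeasurable).1 this
  · refine h1.trans_tendsto ?_
    have : Tendsto (fun t : ℝ => ε * t) atTop atTop := tendsto_id.const_mul_atTop hεpos
    refine (Real.tendsto_exp_neg_atTop_nhds_zero.comp this).congr fun t => ?_
    simp

lemma aux_parts (f f' : ℝ → E) (hf : Continuous f) (hf' : Continuous f')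
    (hd : ∀ t, HasDerivAt f (f' t) t) (h0 : f 0 = 0) (n m : ℤ)
    (hO : f =O[atTop] fun t : ℝ => t ^ n) (hO' : f' =O[atTop] fun t : ℝ => t ^ m)
    (z : ℂ) (hz : 0 < z.im) :
    ∫ t in Ioi (0 : ℝ), Complex.exp (Complex.I * z * (t : ℂ)) • f t =
      (Complex.I / z) • ∫ t in Ioi (0 : ℝ), Complex.exp (Complex.I * z * (t : ℂ)) • f' t := by
  have hz0 : z ≠ 0 := by rintro rfl; simp at hz
  have hre : (Complex.I * z).re < 0 := by simpa using hz
  obtain ⟨i1, t1⟩ := aux_decay f hf n hO Complex.I z hre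
  obtain ⟨i2, -⟩ := aux_decay f' hf' m hO' Complex.I z hre
  have key := integral_Ioi_of_hasDerivAt_of_tendsto (a := 0)
    (f := fun t : ℝ => Complex.exp (Complex.I * z * (t : ℂ)) • f t)
    (f' := fun t : ℝ => Complex.exp (Complex.I * z * (t : ℂ)) • f' t +
      (Complex.I * z) • (Complex.exp (Complex.I * z * (t : ℂ)) • f t)) (m := 0)
    (by fun_prop) ?_ ?_ t1
  · have i3 : IntegrableOn (fun t : ℝ => (Complex.I * z) •
        (Complex.exp (Complex.I * z * (t : ℂ)) • f t)) (Ioi 0) := i1.smul (Complex.I * z)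
    rw [integral_add i2 i3, integral_smul] at key
    simp only [h0, smul_zero, sub_zero] at key
    have h5 : ∫ t in Ioi (0 : ℝ), Complex.exp (Complex.I * z * (t : ℂ)) • f' t =
      -((Complex.I * z) • ∫ t in Ioi (0 : ℝ), Complex.exp (Complex.I * z * (t : ℂ)) • f t) :=
      eq_neg_of_add_eq_zero_left key
    rw [h5, smul_neg, ← neg_smul, smul_smul]
    have : -(Complex.I / z) * (Complex.I * z) = 1 := by
      field_simp; simp
    rw [this, one_smul]
  · intro t _
    have h1 : HasDerivAt (fun w : ℂ => Complex.exp (Complex.I * z * w))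
        (Complex.exp (Complex.I * z * t) * (Complex.I * z)) (t : ℂ) := by
      have : HasDerivAt (fun w : ℂ => Complex.I * z * w) (Complex.I * z) (t : ℂ) := by
        simpa using (hasDerivAt_id (t : ℂ)).const_mul (Complex.I * z)
      exact this.cexp
    have := h1.comp_ofReal.smul (hd t)
    convert! this using 2
    rw [smul_smul, mul_comm]
  · exact i2.add (i1.smul _)

lemma aux_int_line (T : ℝ) (M : ℂ → E) (D : ℝ)
    (hc : ContinuousOn M {t : ℂ | T ≤ t.re})
    (hb : ∀ t : ℂ, T ≤ t.re → ‖M t‖ ≤ D * (1 + ‖t‖ ^ 2)⁻¹) :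
    IntegrableOn (fun s : ℝ => M (T + s * Complex.I)) (Ioi 0) ∧
    IntegrableOn (fun s : ℝ => M s) (Ioi T) := by
  have hD : 0 ≤ D := by
    have h := (norm_nonneg _).trans (hb T (by simp))
    have h2 : 0 < (1 + ‖(T : ℂ)‖ ^ 2)⁻¹ := by positivity
    exact nonneg_of_mul_nonneg_left h h2
  have hg : ∀ s : Set ℝ, IntegrableOn (fun x : ℝ => D * (1 + x ^ 2)⁻¹) s :=
    fun s => (integrable_inv_one_add_sq.const_mul D).integrableOn
  constructor
  · refine (hg _).mono' ?_ ?_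
    · refine ContinuousOn.aestronglyMeasurable ?_ measurableSet_Ioi
      refine hc.comp (by fun_prop) ?_
      intro s _; simp
    · refine Eventually.of_forall fun s => (hb _ (by simp)).trans ?_
      have : |s| ≤ ‖(T + s * Complex.I : ℂ)‖ := by
        simpa using Complex.abs_im_le_norm (T + s * Complex.I : ℂ)
      have h2 : s ^ 2 ≤ ‖(T + s * Complex.I : ℂ)‖ ^ 2 := by
        rw [← sq_abs]; gcongr
      gcongr
  · refine (hg _).mono' ?_ ?_
    · refine ContinuousOn.aestronglyMeasurable ?_ measurableSet_Ioi
      refine hc.comp (by fun_prop) ?_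
      intro s hs; simpa using le_of_lt hs
    · filter_upwards [ae_restrict_mem measurableSet_Ioi] with s hs
      refine (hb _ (by simpa using le_of_lt hs)).trans ?_
      simp

lemma aux_contour (T : ℝ) (hT : 0 < T) (M : ℂ → E) (D : ℝ)
    (hc : ContinuousOn M {t : ℂ | T ≤ t.re})
    (hd : DifferentiableOn ℂ M {t : ℂ | T < t.re})
    (hb : ∀ t : ℂ, T ≤ t.re → ‖M t‖ ≤ D * (1 + ‖t‖ ^ 2)⁻¹)
    (z : ℂ) (hzi : 0 < z.im) (hzr : 0 < z.re) :
    ∫ t in Ioi T, Complex.exp (Complex.I * z * (t : ℂ)) • M t =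
      (Complex.I * Complex.exp (Complex.I * z * T)) •
        ∫ s in Ioi (0 : ℝ), Complex.exp ((-1) * z * (s : ℂ)) • M (T + s * Complex.I) := by
  have hD : 0 ≤ D := by
    have h := (norm_nonneg _).trans (hb T (by simp))
    have h2 : 0 < (1 + ‖(T : ℂ)‖ ^ 2)⁻¹ := by positivity
    exact nonneg_of_mul_nonneg_left h h2
  obtain ⟨I1, I2⟩ := aux_int_line T M D hc hb
  set F : ℂ → E := fun t => Complex.exp (Complex.I * z * t) • M t with hF
  have hFc : ContinuousOn F {t : ℂ | T ≤ t.re} := by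
    refine ContinuousOn.smul (by fun_prop) hc
  have hFd : DifferentiableOn ℂ F {t : ℂ | T < t.re} := by
    refine DifferentiableOn.smul (by fun_prop) hd
  have hexp : ∀ t : ℂ, 0 ≤ t.re → 0 ≤ t.im → ‖Complex.exp (Complex.I * z * t)‖ ≤ 1 := by
    intro t h1 h2
    rw [Complex.norm_exp, Real.exp_le_one_iff]
    simp
    nlinarith [mul_nonneg hzi.le h1, mul_nonneg hzr.le h2]
  have hFb : ∀ t : ℂ, T ≤ t.re → 0 ≤ t.im → ‖F t‖ ≤ ‖M t‖ := by
    intro t h1 h2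
    rw [hF, norm_smul]
    exact mul_le_of_le_one_left (norm_nonneg _) (hexp t (hT.le.trans h1) h2)
  have J1 : IntegrableOn (fun s : ℝ => F (T + s * Complex.I)) (Ioi 0) := by
    refine I1.norm.mono' ?_ ?_
    · refine ContinuousOn.aestronglyMeasurable ?_ measurableSet_Ioi
      refine hFc.comp (by fun_prop) ?_
      intro s _; simp
    · filter_upwards [ae_restrict_mem measurableSet_Ioi] with s hs
      exact hFb _ (by simp) (by simpa using le_of_lt hs)
  have J2 : IntegrableOn (fun s : ℝ => F s) (Ioi T) := by
    refine I2.norm.mono' ?_ ?_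
    · refine ContinuousOn.aestronglyMeasurable ?_ measurableSet_Ioi
      refine hFc.comp (by fun_prop) ?_
      intro s hs; simpa using le_of_lt hs
    · filter_upwards [ae_restrict_mem measurableSet_Ioi] with s hs
      exact hFb _ (by simpa using le_of_lt hs) (by simp)
  have hsum : Tendsto (fun R : ℝ => T + R) atTop atTop := tendsto_atTop_add_const_left _ _ tendsto_id
  have L1 := intervalIntegral_tendsto_integral_Ioi 0 J1 tendsto_id
  have L2 := intervalIntegral_tendsto_integral_Ioi T J2 hsum
  -- small sides
  have small : ∀ R : ℝ, 0 < R → ∀ t : ℂ, T ≤ t.re → 0 ≤ t.im → R ≤ ‖t‖ →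
      ‖F t‖ ≤ D * (R ^ 2)⁻¹ := by
    intro R hR t h1 h2 h3
    refine (hFb t h1 h2).trans ((hb t h1).trans ?_)
    have : R ^ 2 ≤ 1 + ‖t‖ ^ 2 := by
      have : R ^ 2 ≤ ‖t‖ ^ 2 := by gcongr
      linarith
    gcongr
  have hlim : Tendsto (fun R : ℝ => D * R⁻¹) atTop (𝓝 0) := by
    simpa using tendsto_inv_atTop_zero.const_mul D
  have S1 : Tendsto (fun R : ℝ => ∫ x in T..(T + R), F (x + R * Complex.I)) atTop (𝓝 0) := by
    refine squeeze_zero_norm' ?_ hlim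
    filter_upwards [eventually_gt_atTop 0] with R hR
    refine (intervalIntegral.norm_integral_le_of_norm_le_const (C := D * (R ^ 2)⁻¹) ?_).trans ?_
    · intro x hx
      rw [uIoc_of_le (by linarith)] at hx
      refine small R hR _ (by simpa using hx.1.le) (by simpa using hR.le) ?_
      simpa [abs_of_pos hR] using Complex.abs_im_le_norm (x + R * Complex.I : ℂ)
    · rw [add_sub_cancel_left, abs_of_pos hR]
      apply le_of_eq; field_simp
  have S2 : Tendsto (fun R : ℝ => ∫ y in (0 : ℝ)..R, F ((T + R : ℝ) + y * Complex.I)) atTop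
      (𝓝 0) := by
    refine squeeze_zero_norm' ?_ hlim
    filter_upwards [eventually_gt_atTop 0] with R hR
    refine (intervalIntegral.norm_integral_le_of_norm_le_const (C := D * (R ^ 2)⁻¹) ?_).trans ?_
    · intro y hy
      rw [uIoc_of_le hR.le] at hy
      refine small R hR _ (by simpa using hR.le) (by simpa using hy.1.le) ?_
      have := Complex.re_le_norm ((T + R : ℝ) + y * Complex.I : ℂ)
      have h2 : ((T + R : ℝ) + y * Complex.I : ℂ).re = T + R := by simp
      linarith
    · rw [sub_zero, abs_of_pos hR]
      apply le_of_eq; field_simp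
  have rect : ∀ R : ℝ, 0 < R → (∫ x in T..(T + R), F x) =
      (∫ x in T..(T + R), F (x + R * Complex.I)) -
      Complex.I • (∫ y in (0 : ℝ)..R, F ((T + R : ℝ) + y * Complex.I)) +
      Complex.I • (∫ y in (0 : ℝ)..R, F (T + y * Complex.I)) := by
    intro R hR
    have := Complex.integral_boundary_rect_eq_zero_of_continuousOn_of_differentiableOn F
      (T : ℂ) ((T + R : ℝ) + R * Complex.I) ?_ ?_
    · simp at this
      have h2 := this
      simp only [Complex.ofReal_add]
      rw [← sub_eq_zero, ← h2]
      abel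
    · refine hFc.mono ?_
      intro t ht
      have := ht.1
      simp at this
      have h3 : t.re ∈ uIcc T (T + R) := by simpa using this
      rw [uIcc_of_le (by linarith)] at h3
      exact h3.1
    · refine hFd.mono ?_
      intro t ht
      have h3 : t.re ∈ Ioo (min T (T + R)) (max T (T + R)) := by simpa using ht.1
      rw [min_eq_left (by linarith)] at h3
      exact h3.1
  have L3 : Tendsto (fun R : ℝ => ∫ x in T..(T + R), F x) atTop
      (𝓝 ((0 : E) - Complex.I • (0 : E) +
        Complex.I • ∫ s in Ioi (0 : ℝ), F (T + s * Complex.I))) := by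
    refine Tendsto.congr' ?_ ((S1.sub (S2.const_smul Complex.I)).add (L1.const_smul Complex.I))
    filter_upwards [eventually_gt_atTop 0] with R hR
    exact (rect R hR).symm
  have := tendsto_nhds_unique L2 L3
  rw [this, smul_zero, sub_zero, zero_add, mul_smul, ← integral_smul (Complex.exp _)]
  congr 1
  refine integral_congr_ae (Eventually.of_forall fun s => ?_)
  simp only [hF]
  rw [smul_smul, ← Complex.exp_add]
  congr 2
  ring_nf
  simp
  ring

lemma aux_agree (T : ℝ) (N : ℝ → E) (Nt : ℂ → E)
    (hNtHol : DifferentiableOn ℂ Nt {t : ℂ | T < t.re})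
    (hAgree : ∀ t : ℝ, T ≤ t → Nt (t : ℂ) = N t) (j : ℕ) :
    DifferentiableOn ℂ (iteratedDeriv j Nt) {t : ℂ | T < t.re} ∧
    ∀ t : ℝ, T < t → iteratedDeriv j N t = iteratedDeriv j Nt t := by
  have hopen : IsOpen {t : ℂ | T < t.re} := isOpen_lt (by fun_prop) (by fun_prop)
  have hdiff : ∀ j, DifferentiableOn ℂ (iteratedDeriv j Nt) {t : ℂ | T < t.re} := by
    intro j
    rw [iteratedDeriv_eq_iterate]
    exact ((hNtHol.analyticOnNhd hopen).iterated_deriv j).differentiableOn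
  refine ⟨hdiff j, ?_⟩
  induction j with
  | zero => intro t ht; simpa using (hAgree t ht.le).symm
  | succ j ih =>
    intro t ht
    rw [iteratedDeriv_succ, iteratedDeriv_succ]
    have h1 : HasDerivAt (iteratedDeriv j Nt) (deriv (iteratedDeriv j Nt) t) (t : ℂ) :=
      ((hdiff j).differentiableAt (hopen.mem_nhds (by simpa using ht))).hasDerivAt
    have h2 : iteratedDeriv j N =ᶠ[𝓝 t] fun s : ℝ => iteratedDeriv j Nt s := by
      filter_upwards [Ioi_mem_nhds ht] with s hs using ih s hs
    rw [h2.deriv_eq]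
    have h3 : HasDerivAt (fun s : ℝ => iteratedDeriv j Nt (s : ℂ))
        ((1 : ℂ) • deriv (iteratedDeriv j Nt) t) t :=
      HasDerivAt.scomp t h1 (hasDerivAt_id t).ofReal_comp
    rw [one_smul] at h3
    exact h3.deriv

lemma aux_zero (k : ℕ) (N : ℝ → E) (hN : ContDiff ℝ k N)
    (hNzero : ∀ t : ℝ, t ≤ 0 → N t = 0) (j : ℕ) (hj : j ≤ k) : iteratedDeriv j N 0 = 0 := by
  have h1 : ∀ j, ∀ t : ℝ, t < 0 → iteratedDeriv j N t = 0 := by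
    intro j
    induction j with
    | zero => intro t ht; simpa using hNzero t ht.le
    | succ j ih =>
      intro t ht
      rw [iteratedDeriv_succ]
      have : iteratedDeriv j N =ᶠ[𝓝 t] fun _ => 0 := by
        filter_upwards [Iio_mem_nhds ht] with s hs using ih s hs
      rw [this.deriv_eq]; simp
  have hc : Continuous (iteratedDeriv j N) := hN.continuous_iteratedDeriv j (by exact_mod_cast hj)
  have h2 : Tendsto (iteratedDeriv j N) (𝓝[<] 0) (𝓝 (iteratedDeriv j N 0)) :=
    hc.continuousAt.tendsto.mono_left nhdsWithin_le_nhds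
  refine tendsto_nhds_unique h2 (tendsto_const_nhds.congr' ?_)
  filter_upwards [self_mem_nhdsWithin] with t ht
  exact (h1 j t ht).symm

lemma aux_main (T : ℝ) (hT : 0 < T) (j₀ k : ℕ) (hk : j₀ + 2 ≤ k)
    (N : ℝ → E) (hN : ContDiff ℝ k N)
    (hNzero : ∀ t : ℝ, t ≤ 0 → N t = 0)
    (Nt : ℂ → E)
    (hNtHol : DifferentiableOn ℂ Nt {t : ℂ | T < t.re})
    (hNtContDeriv : ∀ j, j ≤ k → ContinuousOn (iteratedDeriv j Nt) {t : ℂ | T ≤ t.re})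
    (hAgree : ∀ t : ℝ, T ≤ t → Nt (t : ℂ) = N t)
    (Cj : ℕ → ℝ)
    (hNtBound : ∀ j, j ≤ k → ∀ t : ℂ, T ≤ t.re →
      ‖iteratedDeriv j Nt t‖ ≤ Cj j * ‖t‖ ^ ((j₀ : ℤ) - (j : ℤ))) :
    ∃ G : ℂ → E,
      DifferentiableOn ℂ G ({z : ℂ | 0 < z.im} ∪ {z : ℂ | 0 < z.re}) ∧
      (∀ z : ℂ, 0 < z.im →
        G z = ∫ t in Ioi (0 : ℝ), Complex.exp (Complex.I * z * (t : ℂ)) • N t) ∧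
      ∀ j, j ≤ k → ∃ C' : ℝ, 0 < C' ∧
        ∀ z ∈ ({z : ℂ | 0 < z.im} ∪ {z : ℂ | 0 < z.re}), 1 < ‖z‖ →
          ‖G z‖ ≤ C' * ‖z‖ ^ (-(j : ℤ)) * Real.exp (T * |z.im|) := by
  have hcont : ∀ j, j ≤ k → Continuous (iteratedDeriv j N) := fun j hj =>
    hN.continuous_iteratedDeriv j (by exact_mod_cast hj)
  have hO : ∀ j, j ≤ k →
      (iteratedDeriv j N) =O[atTop] fun t : ℝ => t ^ ((j₀ : ℤ) - (j : ℤ)) := by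
    intro j hj
    refine Asymptotics.IsBigO.of_bound (Cj j) ?_
    filter_upwards [eventually_gt_atTop T] with t ht
    rw [(aux_agree T N Nt hNtHol hAgree j).2 t ht]
    refine (hNtBound j hj t (by simpa using ht.le)).trans_eq ?_
    rw [Complex.norm_real, norm_zpow]
  -- repeated integration by parts
  have hparts : ∀ z : ℂ, 0 < z.im → ∀ j, j ≤ k →
      ∫ t in Ioi (0 : ℝ), Complex.exp (Complex.I * z * (t : ℂ)) • N t =
      (Complex.I / z) ^ j • ∫ t in Ioi (0 : ℝ),
        Complex.exp (Complex.I * z * (t : ℂ)) • iteratedDeriv j N t := by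
    intro z hz j
    induction j with
    | zero => intro _; simp
    | succ j ih =>
      intro hj
      rw [ih (by omega), aux_parts (iteratedDeriv j N) (iteratedDeriv (j + 1) N)
        (hcont j (by omega)) (hcont (j + 1) hj) ?_ (aux_zero k N hN hNzero j (by omega)) _ _
        (hO j (by omega)) (hO (j + 1) hj) z hz, smul_smul, pow_succ]
      intro t
      rw [iteratedDeriv_succ]
      exact ((hN.differentiable_iteratedDeriv j
        (by exact_mod_cast (by omega : j < k))) t).hasDerivAt
  set M : ℂ → E := iteratedDeriv k Nt with hM
  set n : ℝ → E := iteratedDeriv k N with hn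
  have hMc : ContinuousOn M {t : ℂ | T ≤ t.re} := hNtContDeriv k le_rfl
  obtain ⟨hMd, hMn⟩ := aux_agree T N Nt hNtHol hAgree k
  have hnc : Continuous n := hcont k le_rfl
  -- quadratic decay of `M`
  obtain ⟨D, hD⟩ : ∃ D : ℝ, ∀ t : ℂ, T ≤ t.re → ‖M t‖ ≤ D * (1 + ‖t‖ ^ 2)⁻¹ := by
    obtain ⟨p, hp⟩ := Nat.exists_eq_add_of_le hk
    refine ⟨|Cj k| * (T ^ p)⁻¹ * ((1 + T ^ 2) / T ^ 2), fun t ht => ?_⟩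
    have h1 : T ≤ ‖t‖ := ht.trans (Complex.re_le_norm t)
    have h0 : 0 < ‖t‖ := hT.trans_le h1
    have h2 : ‖t‖ ^ ((j₀ : ℤ) - (k : ℤ)) = (‖t‖ ^ p)⁻¹ * (‖t‖ ^ 2)⁻¹ := by
      have : (j₀ : ℤ) - (k : ℤ) = -((p + 2 : ℕ) : ℤ) := by rw [hp]; push_cast; ring
      rw [this, zpow_neg, zpow_natCast, pow_add, mul_inv]
    have h3 : (‖t‖ ^ 2)⁻¹ ≤ ((1 + T ^ 2) / T ^ 2) * (1 + ‖t‖ ^ 2)⁻¹ := by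
      rw [← div_eq_mul_inv, div_div, inv_eq_one_div, div_le_div_iff₀ (by positivity) (by positivity)]
      have : T ^ 2 ≤ ‖t‖ ^ 2 := by gcongr
      nlinarith
    calc ‖M t‖ ≤ Cj k * ((‖t‖ ^ p)⁻¹ * (‖t‖ ^ 2)⁻¹) := by
          rw [← h2]; exact hNtBound k le_rfl t ht
      _ ≤ |Cj k| * ((T ^ p)⁻¹ * (((1 + T ^ 2) / T ^ 2) * (1 + ‖t‖ ^ 2)⁻¹)) := by
          gcongr
          exact le_abs_self _
      _ = _ := by ring
  obtain ⟨I1, I2⟩ := aux_int_line T M D hMc hD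
  have In1 : IntegrableOn n (Ioc 0 T) := hnc.integrableOn_Ioc
  have In2 : IntegrableOn n (Ioi T) := by
    refine I2.congr_fun ?_ measurableSet_Ioi
    intro t ht
    exact (hMn t ht).symm
  have hunion : Ioc 0 T ∪ Ioi T = Ioi (0 : ℝ) := Ioc_union_Ioi_eq_Ioi hT.le
  have In : IntegrableOn n (Ioi 0) := by
    rw [← hunion]; exact In1.union In2
  set F1 : ℂ → E := fun z => ∫ t in Ioi (0 : ℝ), Complex.exp (Complex.I * z * (t : ℂ)) • n t with hF1
  set F2 : ℂ → E := fun z => (∫ t in Ioc (0 : ℝ) T, Complex.exp (Complex.I * z * (t : ℂ)) • n t) +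
    (Complex.I * Complex.exp (Complex.I * z * T)) •
        ∫ s in Ioi (0 : ℝ), Complex.exp ((-1) * z * (s : ℂ)) • M (T + s * Complex.I) with hF2
  have d1 : ∀ z : ℂ, 0 < z.im → DifferentiableAt ℂ F1 z := fun z hz =>
    aux_diff_Ioi n In Complex.I z (by simpa using hz)
  have d2 : ∀ z : ℂ, 0 < z.re → DifferentiableAt ℂ F2 z := fun z hz => by
    refine (aux_diff_Ioc T n In1 Complex.I z).add (DifferentiableAt.smul (by fun_prop) ?_)
    exact aux_diff_Ioi (fun s : ℝ => M (T + s * Complex.I)) I1 (-1) z (by simpa using hz)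
  have hbd : ∀ z : ℂ, 0 ≤ z.im → ∀ t : ℝ, 0 ≤ t → ‖Complex.exp (Complex.I * z * (t : ℂ))‖ ≤ 1 := by
    intro z hz t ht
    rw [aux_norm_exp, Real.exp_le_one_iff]
    simp
    positivity
  have heq : ∀ z : ℂ, 0 < z.im → 0 < z.re → F1 z = F2 z := by
    intro z hzi hzr
    have hint : IntegrableOn (fun t : ℝ => Complex.exp (Complex.I * z * (t : ℂ)) • n t) (Ioi 0) := by
      refine In.norm.mono' (by fun_prop) ?_
      filter_upwards [ae_restrict_mem measurableSet_Ioi] with t ht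
      rw [norm_smul]
      exact mul_le_of_le_one_left (norm_nonneg _) (hbd z hzi.le t (le_of_lt ht))
    rw [hF1, hF2]
    beta_reduce
    rw [← aux_contour T hT M D hMc hMd hD z hzi hzr, ← hunion,
      setIntegral_union (Ioc_disjoint_Ioi le_rfl) measurableSet_Ioi
        (hint.mono_set (by rw [← hunion]; exact subset_union_left))
        (hint.mono_set (by rw [← hunion]; exact subset_union_right))]
    congr 1
    refine setIntegral_congr_fun measurableSet_Ioi fun t ht => ?_
    rw [hn, hMn t ht]
  -- bounds
  set A := ∫ t in Ioi (0 : ℝ), ‖n t‖ with hA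
  set B := (∫ t in Ioc (0 : ℝ) T, ‖n t‖) + ∫ s in Ioi (0 : ℝ), ‖M (T + s * Complex.I)‖ with hB
  have hA0 : 0 ≤ A := integral_nonneg fun _ => norm_nonneg _
  have hB0 : 0 ≤ B := add_nonneg (integral_nonneg fun _ => norm_nonneg _)
    (integral_nonneg fun _ => norm_nonneg _)
  have b1 : ∀ z : ℂ, 0 < z.im → ‖F1 z‖ ≤ A * Real.exp (T * |z.im|) := by
    intro z hz
    have h1 : ‖F1 z‖ ≤ A := by
      refine norm_integral_le_of_norm_le In.norm ?_
      filter_upwards [ae_restrict_mem measurableSet_Ioi] with t ht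
      rw [norm_smul]
      exact mul_le_of_le_one_left (norm_nonneg _) (hbd z hz.le t (le_of_lt ht))
    refine h1.trans (le_mul_of_one_le_right hA0 (Real.one_le_exp (by positivity)))
  have hexpT : ∀ z : ℂ, ∀ t : ℝ, 0 ≤ t → t ≤ T →
      ‖Complex.exp (Complex.I * z * (t : ℂ))‖ ≤ Real.exp (T * |z.im|) := by
    intro z t h0 h1
    rw [aux_norm_exp, Real.exp_le_exp]
    have h2 : (Complex.I * z).re = - z.im := by simp
    rw [h2]
    have := neg_le_abs z.im
    calc -z.im * t ≤ |z.im| * t := by gcongr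
      _ ≤ |z.im| * T := by gcongr
      _ = _ := mul_comm _ _
  have b2 : ∀ z : ℂ, 0 < z.re → ‖F2 z‖ ≤ B * Real.exp (T * |z.im|) := by
    intro z hz
    refine (norm_add_le _ _).trans ?_
    rw [hB, add_mul]
    gcongr
    · rw [mul_comm (integral _ _), ← integral_const_mul]
      refine norm_integral_le_of_norm_le (In1.norm.const_mul _) ?_
      filter_upwards [ae_restrict_mem measurableSet_Ioc] with t ht
      rw [norm_smul]
      gcongr
      exact hexpT z t ht.1.le ht.2
    · rw [norm_smul, mul_comm, norm_mul, Complex.norm_I, one_mul]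
      gcongr
      · refine norm_integral_le_of_norm_le I1.norm ?_
        filter_upwards [ae_restrict_mem measurableSet_Ioi] with t ht
        have ht : 0 < t := ht
        rw [norm_smul]
        refine mul_le_of_le_one_left (norm_nonneg _) ?_
        rw [aux_norm_exp, Real.exp_le_one_iff]
        simp
        positivity
      · exact hexpT z T hT.le le_rfl
  have hpow : ∀ z : ℂ, z ≠ 0 → DifferentiableAt ℂ (fun z : ℂ => (Complex.I / z) ^ k) z := by
    intro z hz
    exact ((differentiableAt_const _).div differentiableAt_id hz).pow k
  set G : ℂ → E := fun z => (Complex.I / z) ^ k • (if 0 < z.im then F1 z else F2 z) with hG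
  have hG1 : ∀ z : ℂ, 0 < z.im → G z = (Complex.I / z) ^ k • F1 z := by
    intro z hz
    simp only [hG, if_pos hz]
  have hG2 : ∀ z : ℂ, 0 < z.re → G z = (Complex.I / z) ^ k • F2 z := by
    intro z hz
    by_cases h : 0 < z.im
    · rw [hG1 z h, heq z h hz]
    · simp only [hG, if_neg h]
  have hGb : ∀ z ∈ ({z : ℂ | 0 < z.im} ∪ {z : ℂ | 0 < z.re}),
      ‖G z‖ ≤ (‖z‖ ^ k)⁻¹ * ((A + B) * Real.exp (T * |z.im|)) := by
    intro z hz
    have hn : ‖(Complex.I / z) ^ k‖ = (‖z‖ ^ k)⁻¹ := by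
      rw [norm_pow, norm_div, Complex.norm_I, one_div, inv_pow]
    have he := Real.exp_pos (T * |z.im|)
    rcases hz with hz | hz
    · rw [hG1 z hz, norm_smul, hn]
      gcongr
      refine (b1 z hz).trans ?_
      gcongr
      linarith
    · rw [hG2 z hz, norm_smul, hn]
      gcongr
      refine (b2 z hz).trans ?_
      gcongr
      linarith
  refine ⟨G, ?_, ?_, ?_⟩
  · intro z hz
    refine DifferentiableAt.differentiableWithinAt ?_
    rcases hz with hz | hz
    · have hz : 0 < z.im := hz
      have hz0 : z ≠ 0 := by rintro rfl; simp at hz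
      refine ((hpow z hz0).smul (d1 z hz)).congr_of_eventuallyEq ?_
      filter_upwards [(isOpen_lt continuous_const Complex.continuous_im).mem_nhds hz] with w hw
      exact hG1 w hw
    · have hz : 0 < z.re := hz
      have hz0 : z ≠ 0 := by rintro rfl; simp at hz
      refine ((hpow z hz0).smul (d2 z hz)).congr_of_eventuallyEq ?_
      filter_upwards [(isOpen_lt continuous_const Complex.continuous_re).mem_nhds hz] with w hw
      exact hG2 w hw
  · intro z hz
    rw [hG1 z hz, hparts z hz k le_rfl]
  · intro j hj
    refine ⟨A + B + 1, by positivity, fun z hz hz1 => (hGb z hz).trans ?_⟩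
    have h1 : (‖z‖ ^ k)⁻¹ ≤ ‖z‖ ^ (-(j : ℤ)) := by
      rw [zpow_neg, zpow_natCast]
      have : ‖z‖ ^ j ≤ ‖z‖ ^ k := pow_le_pow_right₀ hz1.le hj
      have : 0 < ‖z‖ ^ j := by positivity
      gcongr
    calc _ ≤ ‖z‖ ^ (-(j : ℤ)) * ((A + B + 1) * Real.exp (T * |z.im|)) := by
          gcongr ?_ * (?_ * _)
          linarith
      _ = _ := by ring

end helpers

/-- Right-hand branch of the Fourier transform lemma (Lemma 2.1): a causally
supported `C^k` operator family which is analytic past time `T` with derivative bounds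
`‖Ñ^{(j)}(t)‖ ≤ C_j |t|^{j₀−j}` has a Fourier–Laplace transform continuing holomorphically
to `{Im λ > 0} ∪ {Re λ > 0}` with bounds `C'_j |λ|^{−j} e^{T|Im λ|}` for `|λ| > 1`. -/
theorem fourier_transform_lemma_right_branch
    {H₁ H₂ : Type*} [NormedAddCommGroup H₁] [InnerProductSpace ℂ H₁] [CompleteSpace H₁]
    [NormedAddCommGroup H₂] [InnerProductSpace ℂ H₂] [CompleteSpace H₂]
    (T : ℝ) (hT : 0 < T) (j₀ k : ℕ) (hk : j₀ + 2 ≤ k)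
    (N : ℝ → (H₁ →L[ℂ] H₂)) (hN : ContDiff ℝ (k : ℕ∞) N)
    (hNzero : ∀ t : ℝ, t ≤ 0 → N t = 0)
    (Nt : ℂ → (H₁ →L[ℂ] H₂))
    (hNtHol : DifferentiableOn ℂ Nt {t : ℂ | T < t.re})
    (hNtContDeriv : ∀ j, j ≤ k → ContinuousOn (iteratedDeriv j Nt) {t : ℂ | T ≤ t.re})
    (hAgree : ∀ t : ℝ, T ≤ t → Nt (t : ℂ) = N t)
    (Cj : ℕ → ℝ)
    (hNtBound : ∀ j, j ≤ k → ∀ t : ℂ, T ≤ t.re →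
      ‖iteratedDeriv j Nt t‖ ≤ Cj j * ‖t‖ ^ ((j₀ : ℤ) - (j : ℤ))) :
    ∃ G : ℂ → (H₁ →L[ℂ] H₂),
      DifferentiableOn ℂ G ({z : ℂ | 0 < z.im} ∪ {z : ℂ | 0 < z.re}) ∧
      (∀ z : ℂ, 0 < z.im →
        G z = ∫ t in Ioi (0 : ℝ), Complex.exp (Complex.I * z * (t : ℂ)) • N t) ∧
      ∀ j, j ≤ k → ∃ C' : ℝ, 0 < C' ∧
        ∀ z ∈ ({z : ℂ | 0 < z.im} ∪ {z : ℂ | 0 < z.re}), 1 < ‖z‖ →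
          ‖G z‖ ≤ C' * ‖z‖ ^ (-(j : ℤ)) * Real.exp (T * |z.im|) := by
  exact aux_main T hT j₀ k hk N (by exact_mod_cast hN) hNzero Nt hNtHol hNtContDeriv hAgree Cj hNtBound
end
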